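/- arXiv:1712.06553 — 8 statements merged into one kernel-verified Lean document; each statement's English description precedes it below -/
import Mathlib

section
/- The set of persistent corners of the d-dimensional hypercube equals the set {v : Fin d → Bool | ∀ (i, b, j) ∈ 𝒫, v i = !b}. Moreover, if 𝒫 has no facing panels then this set is nonempty (in particular, there exists a vertex all of whose d incident edges are external). -/
/-- The subcube `C(S, g)`: vertices agreeing with `g` outside `S`. -/
def Cube {d : ℕ} (S : Set (Fin d)) (g : Fin d → Bool) : Set (Fin d → Bool) :=
  {v | ∀ i ∉ S, v i = g i}

/-- A set of panel data: triples `(i, b, j)` with `i ≠ j`. -/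
def IsPanelData {d : ℕ} (P : Set (Fin d × Bool × Fin d)) : Prop :=
  ∀ p ∈ P, p.1 ≠ p.2.2

/-- The edge at vertex `v` in direction `j` is internal: some panel datum
`(i, b, j) ∈ P` with third coordinate `j` satisfies `v i = b`. -/
def InternalEdge {d : ℕ} (P : Set (Fin d × Bool × Fin d)) (v : Fin d → Bool) (j : Fin d) : Prop :=
  ∃ p ∈ P, p.2.2 = j ∧ v p.1 = p.2.1

/-- The edge at vertex `v` in direction `j` is external. -/
def ExternalEdge {d : ℕ} (P : Set (Fin d × Bool × Fin d)) (v : Fin d → Bool) (j : Fin d) : Prop :=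
  ¬ InternalEdge P v j

/-- `P` has no facing panels. -/
def NoFacingPanels {d : ℕ} (P : Set (Fin d × Bool × Fin d)) : Prop :=
  ¬ ∃ i : Fin d, (∃ j, (i, true, j) ∈ P) ∧ (∃ j', (i, false, j') ∈ P)

/-- A persistent corner: every incident edge is external. -/
def PersistentCorner {d : ℕ} (P : Set (Fin d × Bool × Fin d)) (v : Fin d → Bool) : Prop :=
  ∀ j : Fin d, ExternalEdge P v j

/-- The subcube `C(S, g)` is internal. -/
def InternalCube {d : ℕ} (P : Set (Fin d × Bool × Fin d)) (S : Set (Fin d))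
    (g : Fin d → Bool) : Prop :=
  ∃ p ∈ P, p.2.2 ∈ S ∧ p.1 ∉ S ∧ g p.1 = p.2.1

/-- The subcube `C(S, g)` is external. -/
def ExternalCube {d : ℕ} (P : Set (Fin d × Bool × Fin d)) (S : Set (Fin d))
    (g : Fin d → Bool) : Prop :=
  ¬ InternalCube P S g

/-- The subcube `C(S, g)` is completely external: every edge of it is external. -/
def CompletelyExternal {d : ℕ} (P : Set (Fin d × Bool × Fin d)) (S : Set (Fin d))
    (g : Fin d → Bool) : Prop :=
  ∀ v ∈ Cube S g, ∀ j ∈ S, ExternalEdge P v j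

/-- The external-edge graph of the subcube `C(S, g)`. -/
def extGraph {d : ℕ} (P : Set (Fin d × Bool × Fin d)) (S : Set (Fin d))
    (g : Fin d → Bool) : SimpleGraph (Cube S g) :=
  SimpleGraph.fromRel (fun v w =>
    ∃ j : Fin d, (w : Fin d → Bool) = Function.update (v : Fin d → Bool) j (!(v : Fin d → Bool) j)
      ∧ ExternalEdge P (v : Fin d → Bool) j)

theorem persistentCorner_iff {d : ℕ} (P : Set (Fin d × Bool × Fin d)) (v : Fin d → Bool) :
    PersistentCorner P v ↔ ∀ p ∈ P, v p.1 = !p.2.1 := by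
  simp only [PersistentCorner, ExternalEdge, InternalEdge, Bool.eq_not]
  exact ⟨fun h p hp hv => h p.2.2 ⟨p, hp, rfl, hv⟩, fun h _ ⟨p, hp, _, hv⟩ => h p hp hv⟩

theorem NoFacingPanels.exists_persistentCorner {d : ℕ} {P : Set (Fin d × Bool × Fin d)}
    (h : NoFacingPanels P) : ∃ v, PersistentCorner P v := by
  classical
  refine ⟨fun i => decide (∃ j, (i, false, j) ∈ P), (persistentCorner_iff P _).2 ?_⟩
  rintro ⟨i, b, j⟩ hp
  cases b with
  | false => exact decide_eq_true ⟨j, hp⟩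
  | true => exact decide_eq_false fun hf => h ⟨i, ⟨j, hp⟩, hf⟩

/-- The set of persistent corners of the `d`-cube equals
`{v | ∀ (i, b, j) ∈ P, v i = !b}`; moreover if `P` has no facing panels then this
set is nonempty. -/
theorem persistent_corners_eq_and_nonempty (d : ℕ) (P : Set (Fin d × Bool × Fin d))
    (hP : IsPanelData P) :
    {v : Fin d → Bool | PersistentCorner P v} = {v : Fin d → Bool | ∀ p ∈ P, v p.1 = !p.2.1} ∧
      (NoFacingPanels P → {v : Fin d → Bool | PersistentCorner P v}.Nonempty) := by
  exact ⟨Set.ext (persistentCorner_iff P), NoFacingPanels.exists_persistentCorner⟩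
end

section
/- Suppose 𝒫 has no facing panels. If the external-edge graph of the full hypercube (the subcube with S = Fin d) is connected, then for every external subcube C(S, g), the external-edge graph of C(S, g) is connected. -/
/-- Without facing panels, every coordinate carries panels on at most one side. -/
theorem NoFacingPanels.exists_side {d : ℕ} {P : Set (Fin d × Bool × Fin d)}
    (hnf : NoFacingPanels P) :
    ∃ σ : Fin d → Bool, ∀ i b j, (i, b, j) ∈ P → b = σ i := by
  classical
  refine ⟨fun i => decide (∃ j, (i, true, j) ∈ P), fun i b j h => ?_⟩
  cases b with
  | true => simpa using ⟨j, h⟩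
  | false =>
    have hi : ¬ ∃ j, (i, true, j) ∈ P := fun h' => hnf ⟨i, h', j, h⟩
    simp [hi]

/-- An edge is external at one endpoint iff it is external at the other. -/
theorem externalEdge_update_iff {d : ℕ} {P : Set (Fin d × Bool × Fin d)} (hP : IsPanelData P)
    (v : Fin d → Bool) (j : Fin d) (b : Bool) :
    ExternalEdge P (Function.update v j b) j ↔ ExternalEdge P v j := by
  refine not_congr (exists_congr fun p => and_congr_right fun hp => and_congr_right fun hj => ?_)
  rw [Function.update_of_ne (hj ▸ hP p hp)]

/-- Adjacent vertices differ by flipping one coordinate along an edge external at the first. -/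
theorem exists_update_of_extGraph_adj {d : ℕ} {P : Set (Fin d × Bool × Fin d)}
    (hP : IsPanelData P) {S : Set (Fin d)} {g : Fin d → Bool} {v w : Cube S g}
    (h : (extGraph P S g).Adj v w) :
    ∃ j, w.1 = Function.update v.1 j (!v.1 j) ∧ ExternalEdge P v.1 j := by
  rw [extGraph, SimpleGraph.fromRel_adj] at h
  obtain ⟨-, h | ⟨j, hv, hj⟩⟩ := h
  · exact h
  · refine ⟨j, ?_, ?_⟩
    · simp [hv]
    · rwa [hv, externalEdge_update_iff hP]

/-- If the external-edge graph of the full cube is connected, the relation that some panel in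
coordinate `i` blocks direction `j` is well-founded: a set `T` without minimal element would freeze
all coordinates in `T` of the vertex lying on every panel. -/
theorem wellFounded_of_extGraph_univ_connected {d : ℕ} {P : Set (Fin d × Bool × Fin d)}
    (hP : IsPanelData P) {g : Fin d → Bool} (hconn : (extGraph P Set.univ g).Connected)
    {σ : Fin d → Bool} (hσ : ∀ i b j, (i, b, j) ∈ P → b = σ i) :
    WellFounded fun i j : Fin d => ∃ b, (i, b, j) ∈ P := by
  rw [WellFounded.wellFounded_iff_has_min]
  intro T ⟨t, ht⟩
  by_contra! hT
  have frozen : ∀ v : Cube Set.univ g,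
      (extGraph P Set.univ g).Reachable ⟨σ, fun i hi => (hi trivial).elim⟩ v →
        ∀ i ∈ T, v.1 i = σ i := by
    intro v hv
    rw [SimpleGraph.reachable_iff_reflTransGen] at hv
    induction hv with
    | refl => exact fun _ _ => rfl
    | tail _ hadj ih =>
      obtain ⟨j, hw, hj⟩ := exists_update_of_extGraph_adj hP hadj
      intro i hi
      have hij : i ≠ j := by
        rintro rfl
        obtain ⟨k, hk, b, hb⟩ := hT i hi
        exact hj ⟨_, hb, rfl, (ih k hk).trans (hσ _ _ _ hb).symm⟩
      rw [hw, Function.update_of_ne hij, ih i hi]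
  have := frozen ⟨fun i => !σ i, fun i hi => (hi trivial).elim⟩ (hconn.preconnected _ _) t ht
  simp at this

/-- In an external subcube, every vertex is joined by external edges to the vertex opposite to
all panels, by flipping minimal coordinates lying on panels. -/
theorem extGraph_reachable_opposite {d : ℕ} {P : Set (Fin d × Bool × Fin d)} {σ : Fin d → Bool}
    (hσ : ∀ i b j, (i, b, j) ∈ P → b = σ i)
    (hwf : WellFounded fun i j : Fin d => ∃ b, (i, b, j) ∈ P)
    {S : Set (Fin d)} {g : Fin d → Bool} (hS : ExternalCube P S g)
    {w : Cube S g} (hw : ∀ i ∈ S, w.1 i = !σ i) (v : Cube S g) :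
    (extGraph P S g).Reachable v w := by
  induction hn : {i | i ∈ S ∧ v.1 i = σ i}.ncard using Nat.strong_induction_on generalizing v with
  | _ n ih =>
  obtain hA | hA := {i | i ∈ S ∧ v.1 i = σ i}.eq_empty_or_nonempty
  · have hvw : v = w := by
      ext i
      by_cases hi : i ∈ S
      · have hne : v.1 i ≠ σ i := fun h => (hA ▸ ⟨hi, h⟩ : i ∈ (∅ : Set (Fin d)))
        rw [hw i hi, Bool.eq_not.mpr hne]
      · rw [v.2 i hi, w.2 i hi]
    exact hvw ▸ SimpleGraph.Reachable.refl _
  · obtain ⟨j, ⟨hjS, hj⟩, hmin⟩ := hwf.has_min _ hA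
    have hext : ExternalEdge P v.1 j := by
      rintro ⟨⟨i, b, k⟩, hp, rfl, hb⟩
      by_cases hi : i ∈ S
      · exact hmin i ⟨hi, hb.trans (hσ _ _ _ hp)⟩ ⟨b, hp⟩
      · exact hS ⟨_, hp, hjS, hi, (v.2 i hi).symm.trans hb⟩
    let u : Cube S g := ⟨Function.update v.1 j (!v.1 j), fun i hi => by
      rw [Function.update_of_ne (ne_of_mem_of_not_mem hjS hi).symm, v.2 i hi]⟩
    have hadj : (extGraph P S g).Adj v u := by
      rw [extGraph, SimpleGraph.fromRel_adj]
      refine ⟨fun h => ?_, Or.inl ⟨j, rfl, hext⟩⟩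
      have := congrFun (congrArg Subtype.val h) j
      simp [u] at this
    refine hadj.reachable.trans (ih _ ?_ u rfl)
    rw [← hn]
    refine Set.ncard_lt_ncard ⟨fun i hi => ?_, fun h => ?_⟩
    · have hij : i ≠ j := by
        rintro rfl
        have := hi.2
        simp [u, hj] at this
      exact ⟨hi.1, by simpa [u, hij] using hi.2⟩
    · have := (h ⟨hjS, hj⟩).2
      simp [u, hj] at this

/-- If `P` has no facing panels and the external-edge graph of the
full hypercube is connected, then the external-edge graph of every external subcube
is connected. -/
theorem extGraph_connected_of_external (d : ℕ) (P : Set (Fin d × Bool × Fin d))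
    (hP : IsPanelData P) (hnf : NoFacingPanels P)
    (hconn : (extGraph P (Set.univ : Set (Fin d)) (fun _ => false)).Connected) :
    ∀ (S : Set (Fin d)) (g : Fin d → Bool), ExternalCube P S g →
      (extGraph P S g).Connected := by
  intro S g hS
  classical
  obtain ⟨σ, hσ⟩ := hnf.exists_side
  have hwf := wellFounded_of_extGraph_univ_connected hP hconn hσ
  let w : Cube S g := ⟨fun i => if i ∈ S then !σ i else g i, fun i hi => if_neg hi⟩
  have reach := extGraph_reachable_opposite hσ hwf hS (w := w) fun i hi => if_pos hi
  exact (SimpleGraph.connected_iff _).mpr ⟨fun a b => (reach a).trans (reach b).symm, ⟨w⟩⟩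
end

section
/- Suppose 𝒫 has no facing panels and the external-edge graph of the full hypercube (the subcube with S = Fin d) is connected. If C(S, g) is a proper completely external subcube, then there exists k ∉ S such that 𝒫 contains no panel datum of the form (k, g k, j); consequently the codimension-1 face C({k}ᶜ, g), which contains C(S, g), is external. -/
/-- A self-map of a nonempty finite type maps some nonempty subset onto itself. -/
lemma exists_nonempty_image_eq {α : Type*} [Finite α] [Nonempty α] (f : α → α) :
    ∃ T : Set α, T.Nonempty ∧ f '' T = T := by
  obtain ⟨T, ⟨hT, hfT⟩, hmin⟩ :=
    (Set.toFinite {T : Set α | T.Nonempty ∧ f '' T ⊆ T}).exists_minimal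
      ⟨Set.univ, Set.univ_nonempty, Set.subset_univ _⟩
  exact ⟨T, hT, hfT.antisymm (hmin ⟨hT.image f, Set.image_mono hfT⟩ hfT)⟩

/-- If every direction in `T` is blocked by a panel `(s, g s, t)` with `s ∈ T`, then agreeing
with `g` on `T` is preserved along external edges. -/
lemma ExternalEdge.eqOn_iff {d : ℕ} {P : Set (Fin d × Bool × Fin d)} (hP : IsPanelData P)
    {T : Set (Fin d)} {g : Fin d → Bool} (hT : ∀ t ∈ T, ∃ s ∈ T, (s, g s, t) ∈ P)
    {v : Fin d → Bool} {j : Fin d} (hv : ExternalEdge P v j) :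
    Set.EqOn v g T ↔ Set.EqOn (Function.update v j (!v j)) g T := by
  by_cases hj : j ∈ T
  · obtain ⟨s, hs, hp⟩ := hT j hj
    have hsj : s ≠ j := hP _ hp
    have hvs : v s ≠ g s := fun h => hv ⟨_, hp, rfl, h⟩
    refine iff_of_false (fun h => hvs (h hs)) fun h => hvs ?_
    simpa [hsj] using h hs
  · refine forall₂_congr fun t ht => ?_
    rw [Function.update_of_ne (ne_of_mem_of_not_mem ht hj)]

/-- If the external-edge graph of the full hypercube is connected, then no nonempty set `T` of
directions is blocked by panels `(s, g s, t)` with `s ∈ T`. -/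
lemma not_forall_exists_panel_of_connected {d : ℕ} {P : Set (Fin d × Bool × Fin d)}
    (hP : IsPanelData P) {g₀ : Fin d → Bool} (hconn : (extGraph P Set.univ g₀).Connected)
    {T : Set (Fin d)} (hne : T.Nonempty) (g : Fin d → Bool) :
    ¬ ∀ t ∈ T, ∃ s ∈ T, (s, g s, t) ∈ P := by
  intro hT
  have key : ∀ v w : Cube Set.univ g₀, (extGraph P Set.univ g₀).Reachable v w →
      Set.EqOn v.1 g T → Set.EqOn w.1 g T := by
    rintro v w ⟨p⟩
    induction p with
    | nil => exact id
    | cons h _ ih =>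
      refine fun hv => ih ?_
      obtain ⟨-, ⟨j, hj, he⟩ | ⟨j, hj, he⟩⟩ := h
      · rw [hj]
        exact (he.eqOn_iff hP hT).1 hv
      · rw [hj] at hv
        exact (he.eqOn_iff hP hT).2 hv
  obtain ⟨t, ht⟩ := hne
  have := key ⟨g, fun i hi => (hi trivial).elim⟩ ⟨fun i => !g i, fun i hi => (hi trivial).elim⟩
    (hconn.preconnected _ _) (fun _ _ => rfl) ht
  simp at this

/-- If every `k ∉ S` carries a panel on the side of `g`, no panel blocks a direction of a
completely external subcube `C(S, g)`. -/
lemma CompletelyExternal.notMem_of_mem {d : ℕ} {P : Set (Fin d × Bool × Fin d)}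
    (hnf : NoFacingPanels P) {S : Set (Fin d)} {g : Fin d → Bool}
    (hce : CompletelyExternal P S g) (hS : ∀ k ∉ S, ∃ j, (k, g k, j) ∈ P)
    {i j : Fin d} {b : Bool} (hp : (i, b, j) ∈ P) : j ∉ S := by
  intro hj
  by_cases hi : i ∈ S
  · refine hce (Function.update g i b) (fun k hk => ?_) j hj ⟨_, hp, rfl, by simp⟩
    exact Function.update_of_ne (ne_of_mem_of_not_mem hi hk).symm _ _
  · refine hce g (fun _ _ => rfl) j hj ⟨_, hp, rfl, ?_⟩
    obtain ⟨j', hj'⟩ := hS i hi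
    by_contra hb
    rw [← ne_eq, ← Bool.eq_not] at hb
    refine hnf ⟨i, ?_⟩
    cases b <;> simp_all <;> exact ⟨⟨_, by assumption⟩, ⟨_, by assumption⟩⟩

/-- If `P` has no facing panels and the external-edge graph of the
full hypercube is connected, then every proper completely external subcube `C(S, g)`
admits `k ∉ S` such that no panel datum of the form `(k, g k, j)` lies in `P`; hence
the codimension-1 face `C({k}ᶜ, g)`, which contains `C(S, g)`, is external. -/
theorem completelyExternal_subset_external_face (d : ℕ) (P : Set (Fin d × Bool × Fin d))
    (hP : IsPanelData P) (hnf : NoFacingPanels P)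
    (hconn : (extGraph P (Set.univ : Set (Fin d)) (fun _ => false)).Connected)
    (S : Set (Fin d)) (g : Fin d → Bool)
    (hce : CompletelyExternal P S g)
    (hproper : Cube S g ≠ (Set.univ : Set (Fin d → Bool))) :
    ∃ k ∉ S, (¬ ∃ j : Fin d, (k, g k, j) ∈ P) ∧
      Cube S g ⊆ Cube ({k}ᶜ : Set (Fin d)) g ∧ ExternalCube P ({k}ᶜ : Set (Fin d)) g := by
  suffices h : ∃ k ∉ S, ¬ ∃ j : Fin d, (k, g k, j) ∈ P by
    obtain ⟨k, hk, hkP⟩ := h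
    refine ⟨k, hk, hkP, fun v hv i hi => ?_, ?_⟩
    · obtain rfl : i = k := by simpa using hi
      exact hv i hk
    · rintro ⟨⟨i, b, j⟩, hp, -, hi, hb⟩
      obtain rfl : i = k := by simpa using hi
      obtain rfl : g i = b := hb
      exact hkP ⟨j, hp⟩
  by_contra! hS
  have : Nonempty {k // k ∉ S} := by
    by_contra hempty
    refine hproper (Set.eq_univ_of_forall fun v i hi => (hempty ⟨⟨i, hi⟩⟩).elim)
  choose f hf using hS
  obtain ⟨T, hne, hT⟩ := exists_nonempty_image_eq fun k : {k // k ∉ S} =>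
    (⟨f k k.2, hce.notMem_of_mem hnf (fun k hk => ⟨_, hf k hk⟩) (hf k k.2)⟩ : {k // k ∉ S})
  refine not_forall_exists_panel_of_connected hP hconn (hne.image Subtype.val) g ?_
  rintro _ ⟨t, ht, rfl⟩
  rw [← hT] at ht
  obtain ⟨s, hs, rfl⟩ := ht
  exact ⟨s, ⟨s, hs, rfl⟩, hf s s.2⟩
end

section
/- Suppose 𝒫 has no facing panels and the external-edge graph of the full hypercube (the subcube with S = Fin d) is connected. Then 𝒟 is a strong deformation retract of the geometric cube: there exists a continuous map H from (Fin d → Set.Icc (0:ℝ) 1) × Set.Icc (0:ℝ) 1 to Fin d → Set.Icc (0:ℝ) 1 such that H(x, 0) = x for all x, H(x, 1) ∈ 𝒟 for all x, and H(a, t) = a for all a ∈ 𝒟 and all t. In particular, 𝒟 (with the subspace topology) is a contractible topological space. -/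
/-- The geometric realization of the subcube `C(S, g)` inside the geometric cube
`Fin d → Set.Icc (0:ℝ) 1`. -/
def geomCube {d : ℕ} (S : Set (Fin d)) (g : Fin d → Bool) :
    Set (Fin d → Set.Icc (0:ℝ) 1) :=
  {x | ∀ i ∉ S, (x i : ℝ) = if g i then 1 else 0}

/-- `𝒟`: the union of the geometric realizations of all completely external subcubes. -/
def Dset {d : ℕ} (P : Set (Fin d × Bool × Fin d)) : Set (Fin d → Set.Icc (0:ℝ) 1) :=
  ⋃ (S : Set (Fin d)) (g : Fin d → Bool) (_ : CompletelyExternal P S g), geomCube S g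

/-- The points of the unit cube whose `i`-th coordinate equals `z i` for `i ∈ Z`, and such that for
every relation `R i j` inside `T` the `j`-th coordinate is an endpoint or the `i`-th one is `z i`. -/
def panelLocus {ι : Type*} (R : ι → ι → Prop) (z : ι → ℝ) (T : Finset ι) (Z : Set ι) :
    Set (ι → ℝ) :=
  {x | (∀ i, x i ∈ Set.Icc (0 : ℝ) 1) ∧ (∀ i ∈ Z, x i = z i) ∧
    ∀ i ∈ T, ∀ j ∈ T, R i j → (x j = 0 ∨ x j = 1) ∨ x i = z i}

/-- `A` is the image of a continuous retraction of the ambient space. -/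
def IsRetractOfSpace {X : Type*} [TopologicalSpace X] (A : Set X) : Prop :=
  ∃ r : X → X, Continuous r ∧ (∀ x, r x ∈ A) ∧ ∀ x ∈ A, r x = x

theorem panelLocus_empty_retract {ι : Type*} (R : ι → ι → Prop) (z : ι → ℝ)
    (hz : ∀ i, z i = 0 ∨ z i = 1) (Z : Set ι) :
    IsRetractOfSpace (panelLocus R z ∅ Z) := by
  classical
  refine ⟨fun x i => if i ∈ Z then z i else max 0 (min 1 (x i)), ?_, ?_, ?_⟩
  · refine continuous_pi fun i => ?_
    by_cases h : i ∈ Z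
    · simpa [h] using continuous_const
    · simp only [h, if_false]
      fun_prop
  · intro x
    refine ⟨fun i => ?_, fun i hi => by simp [hi], by simp⟩
    by_cases h : i ∈ Z
    · rcases hz i with h0 | h0 <;> simp [h, h0]
    · simp [h]
  · rintro x ⟨hx, hxZ, -⟩
    funext i
    by_cases h : i ∈ Z
    · simp [h, hxZ i h]
    · simp [h, (hx i).1, (hx i).2]

/-- If `A ⊆ B` are retracts of Euclidean space inside the unit cube, both closed under changing the
coordinate `s` within the unit interval, then the part of `B` where the coordinate `s` is an
endpoint or the point lies in `A` is a retract too. -/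
theorem IsRetractOfSpace.endpoint_or_mem {ι : Type*} [Fintype ι] [DecidableEq ι]
    {A B : Set (ι → ℝ)} (s : ι) (hA : IsRetractOfSpace A) (hB : IsRetractOfSpace B) (hAB : A ⊆ B)
    (hcube : ∀ x ∈ B, ∀ i, x i ∈ Set.Icc (0 : ℝ) 1)
    (hAs : ∀ x ∈ A, ∀ w ∈ Set.Icc (0 : ℝ) 1, Function.update x s w ∈ A)
    (hBs : ∀ x ∈ B, ∀ w ∈ Set.Icc (0 : ℝ) 1, Function.update x s w ∈ B) :
    IsRetractOfSpace {x ∈ B | (x s = 0 ∨ x s = 1) ∨ x ∈ A} := by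
  obtain ⟨ρ, hρc, hρA, hρ⟩ := hA
  obtain ⟨r, hrc, hrB, hr⟩ := hB
  set δ : (ι → ℝ) → ℝ := fun x => dist (r x) (ρ (r x)) with hδ
  have hδc : Continuous δ := hrc.dist (hρc.comp hrc)
  have hδ0 : ∀ x, 0 ≤ δ x := fun x => dist_nonneg
  have hδ1 : ∀ x, δ x ≤ 1 := by
    intro x
    refine (dist_pi_le_iff zero_le_one).2 fun i => ?_
    have h1 := hcube _ (hrB x) i
    have h2 := hcube _ (hAB (hρA (r x))) i
    rw [Real.dist_eq, abs_le]
    constructor <;> linarith [h1.1, h1.2, h2.1, h2.2]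
  set c : (ι → ℝ) → ℝ := fun x => max 0 (δ x - 3 * min (x s) (1 - x s)) with hc
  set w : (ι → ℝ) → ℝ := fun x => max 0 (min 1 ((x s - δ x / 3) / (1 - 2 * (δ x / 3)))) with hw
  set p : (ι → ℝ) → ι → ℝ :=
    fun x i => ρ (r x) i + max (-c x) (min (c x) (r x i - ρ (r x) i)) with hp
  have hden : ∀ x, 0 < 1 - 2 * (δ x / 3) := fun x => by linarith [hδ1 x]
  have hcc : Continuous c := by fun_prop
  have hwc : Continuous w := by
    have : Continuous fun x : ι → ℝ => (x s - δ x / 3) / (1 - 2 * (δ x / 3)) :=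
      Continuous.div (by fun_prop) (by fun_prop) fun x => (hden x).ne'
    fun_prop
  have hpc : Continuous p := by fun_prop
  have hw01 : ∀ x, w x ∈ Set.Icc (0 : ℝ) 1 := fun x => by simp [hw]
  have hp_zero : ∀ x, c x = 0 → p x = ρ (r x) := by
    intro x hx
    funext i
    simp [hp, hx]
  have hp_full : ∀ x, δ x ≤ c x → p x = r x := by
    intro x hx
    funext i
    have h1 : |r x i - ρ (r x) i| ≤ c x := (dist_le_pi_dist (r x) (ρ (r x)) i).trans hx
    rw [abs_le] at h1
    simp only [hp]
    rw [min_eq_right h1.2, max_eq_right h1.1]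
    ring
  refine ⟨fun x => Function.update (r (p x)) s (w x), ?_, ?_, ?_⟩
  · exact (hrc.comp hpc).update s hwc
  · intro x
    refine ⟨hBs _ (hrB _) _ (hw01 x), ?_⟩
    simp only [Function.update_self]
    by_cases h0 : x s ≤ δ x / 3
    · refine Or.inl (Or.inl ?_)
      have : (x s - δ x / 3) / (1 - 2 * (δ x / 3)) ≤ 0 :=
        div_nonpos_of_nonpos_of_nonneg (by linarith) (hden x).le
      exact max_eq_left ((min_le_right _ _).trans this)
    by_cases h1 : 1 - δ x / 3 ≤ x s
    · refine Or.inl (Or.inr ?_)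
      have : 1 ≤ (x s - δ x / 3) / (1 - 2 * (δ x / 3)) := by
        rw [le_div_iff₀ (hden x)]
        linarith
      simp [hw, min_eq_left this]
    · push Not at h0 h1
      have hc0 : c x = 0 := by
        have : δ x / 3 ≤ min (x s) (1 - x s) := le_min h0.le (by linarith)
        exact max_eq_left (by linarith)
      rw [hp_zero x hc0, hr _ (hAB (hρA _))]
      exact Or.inr (hAs _ (hρA _) _ (hw01 x))
  · rintro x ⟨hxB, hx⟩
    have hrx : r x = x := hr x hxB
    have hxs := hcube x hxB s
    by_cases hxA : x ∈ A
    · have hρx : ρ x = x := hρ x hxA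
      have hd : δ x = 0 := by simp [hδ, hrx, hρx]
      have hpx : p x = x := by
        rw [hp_full x (by rw [hd]; exact le_max_left _ _), hrx]
      have hwx : w x = x s := by simp [hw, hd, hxs.1, hxs.2]
      simp [hpx, hrx, hwx]
    · replace hx := hx.resolve_right hxA
      have hpx : p x = x := by
        rw [hp_full x ?_, hrx]
        rcases hx with hx | hx <;> simp [hc, hx]
      have hwx : w x = x s := by
        rcases hx with hx | hx
        · have : (x s - δ x / 3) / (1 - 2 * (δ x / 3)) ≤ 0 :=
            div_nonpos_of_nonpos_of_nonneg (by linarith [hδ0 x]) (hden x).le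
          rw [hx] at this ⊢
          simpa [hw, hx] using Or.inr this
        · have : 1 ≤ (x s - δ x / 3) / (1 - 2 * (δ x / 3)) := by
            rw [le_div_iff₀ (hden x)]
            linarith [hδ0 x]
          simp only [hw]
          rw [min_eq_left this, hx]
          simp
      simp [hpx, hrx, hwx]

theorem panelLocus_update_mem {ι : Type*} [DecidableEq ι] {R : ι → ι → Prop} {z : ι → ℝ}
    {T : Finset ι} {Z : Set ι} {s : ι} (hsT : s ∉ T) (hsZ : s ∉ Z) {x : ι → ℝ}
    (hx : x ∈ panelLocus R z T Z) {w : ℝ} (hw : w ∈ Set.Icc (0 : ℝ) 1) :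
    Function.update x s w ∈ panelLocus R z T Z := by
  obtain ⟨h1, h2, h3⟩ := hx
  refine ⟨fun i => ?_, fun i hi => ?_, fun i hi j hj hij => ?_⟩
  · by_cases h : i = s
    · subst h
      simpa using hw
    · simpa [h] using h1 i
  · rw [Function.update_of_ne (ne_of_mem_of_not_mem hi hsZ)]
    exact h2 i hi
  · rw [Function.update_of_ne (ne_of_mem_of_not_mem hi hsT),
      Function.update_of_ne (ne_of_mem_of_not_mem hj hsT)]
    exact h3 i hi j hj hij

theorem panelLocus_retract {ι : Type*} [Fintype ι] (R : ι → ι → Prop)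
    (hR : WellFounded (Function.swap R)) (z : ι → ℝ) (hz : ∀ i, z i = 0 ∨ z i = 1)
    (T : Finset ι) (Z : Set ι) : IsRetractOfSpace (panelLocus R z T Z) := by
  classical
  induction T using Finset.strongInduction generalizing Z with
  | H T ih =>
    rcases T.eq_empty_or_nonempty with rfl | hT
    · exact panelLocus_empty_retract R z hz Z
    obtain ⟨s, hsT, hs⟩ := hR.has_min (T : Set ι) hT
    have hsink : ∀ j ∈ T, ¬ R s j := hs
    have hlt : T.erase s ⊂ T := Finset.erase_ssubset hsT
    by_cases hsZ : s ∈ Z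
    · convert ih _ hlt Z using 1
      ext x
      refine ⟨fun ⟨h1, h2, h3⟩ => ⟨h1, h2, fun i hi j hj => h3 i (Finset.mem_of_mem_erase hi) j
        (Finset.mem_of_mem_erase hj)⟩, fun ⟨h1, h2, h3⟩ => ⟨h1, h2, fun i hi j hj hij => ?_⟩⟩
      have his : i ≠ s := by
        rintro rfl
        exact hsink j hj hij
      by_cases hjs : j = s
      · subst hjs
        rw [h2 j hsZ]
        exact Or.inl (hz j)
      · exact h3 i (Finset.mem_erase.2 ⟨his, hi⟩) j (Finset.mem_erase.2 ⟨hjs, hj⟩) hij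
    · have hs' : s ∉ T.erase s := Finset.notMem_erase s T
      have hsZ' : s ∉ Z ∪ {i | i ∈ T ∧ R i s} := by
        rintro (h | h)
        · exact hsZ h
        · exact hsink s hsT h.2
      convert (ih _ hlt (Z ∪ {i | i ∈ T ∧ R i s})).endpoint_or_mem s (ih _ hlt Z)
        (fun x hx => ⟨hx.1, fun i hi => hx.2.1 i (Or.inl hi), hx.2.2⟩) (fun x hx => hx.1)
        (fun x hx w hw => panelLocus_update_mem hs' hsZ' hx hw)
        (fun x hx w hw => panelLocus_update_mem hs' hsZ hx hw) using 1
      ext x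
      constructor
      · rintro ⟨h1, h2, h3⟩
        have h3' : ∀ i ∈ T.erase s, ∀ j ∈ T.erase s, R i j → (x j = 0 ∨ x j = 1) ∨ x i = z i :=
          fun i hi j hj => h3 i (Finset.mem_of_mem_erase hi) j (Finset.mem_of_mem_erase hj)
        refine ⟨⟨h1, h2, h3'⟩, ?_⟩
        by_cases hx : x s = 0 ∨ x s = 1
        · exact Or.inl hx
        · refine Or.inr ⟨h1, ?_, h3'⟩
          rintro i (hi | ⟨hi, his⟩)
          · exact h2 i hi
          · exact (h3 i hi s hsT his).resolve_left hx
      · rintro ⟨⟨h1, h2, h3⟩, h4⟩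
        refine ⟨h1, h2, fun i hi j hj hij => ?_⟩
        have his : i ≠ s := by
          rintro rfl
          exact hsink j hj hij
        by_cases hjs : j = s
        · subst hjs
          exact h4.imp_right fun h => h.2.1 i (Or.inr ⟨hi, hij⟩)
        · exact h3 i (Finset.mem_erase.2 ⟨his, hi⟩) j (Finset.mem_erase.2 ⟨hjs, hj⟩) hij

/-- Coordinate `i` carries a panel that makes edges in direction `j` internal. -/
def PanelRel {d : ℕ} (P : Set (Fin d × Bool × Fin d)) (i j : Fin d) : Prop :=
  ∃ b, (i, b, j) ∈ P

open Classical in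
/-- The side of coordinate `i` on which its panels lie. -/
noncomputable def panelSide {d : ℕ} (P : Set (Fin d × Bool × Fin d)) (i : Fin d) : Bool :=
  decide (∃ j, (i, true, j) ∈ P)

theorem NoFacingPanels.eq_panelSide {d : ℕ} {P : Set (Fin d × Bool × Fin d)}
    (hnf : NoFacingPanels P) {i j : Fin d} {b : Bool} (h : (i, b, j) ∈ P) : b = panelSide P i := by
  cases b with
  | true => simpa [panelSide] using ⟨j, h⟩
  | false =>
    have : ¬ ∃ j, (i, true, j) ∈ P := fun h' => hnf ⟨i, h', j, h⟩
    simpa [panelSide] using this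

theorem wellFounded_panelRel {d : ℕ} {P : Set (Fin d × Bool × Fin d)} (hP : IsPanelData P)
    (hnf : NoFacingPanels P)
    (hconn : (extGraph P (Set.univ : Set (Fin d)) (fun _ => false)).Connected) :
    WellFounded (PanelRel P) := by
  rw [WellFounded.wellFounded_iff_has_min]
  intro T hT
  by_contra! hno
  have key : ∀ v w, (extGraph P (Set.univ : Set (Fin d)) (fun _ => false)).Reachable v w →
      (∀ i ∈ T, v.1 i = panelSide P i) → ∀ i ∈ T, w.1 i = panelSide P i := by
    rintro v w ⟨walk⟩
    induction walk with
    | nil => exact id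
    | @cons u v w hadj _ ih =>
      refine fun hu => ih fun i hi => ?_
      rw [extGraph, SimpleGraph.fromRel_adj] at hadj
      rcases hadj.2 with ⟨j, hj, hext⟩ | ⟨j, hj, hext⟩
      · have hjT : j ∉ T := by
          intro hjT
          obtain ⟨k, hk, b, hb⟩ := hno j hjT
          exact hext ⟨_, hb, rfl, (hu k hk).trans (hnf.eq_panelSide hb).symm⟩
        rw [hj, Function.update_of_ne (ne_of_mem_of_not_mem hi hjT)]
        exact hu i hi
      · have hjT : j ∉ T := by
          intro hjT
          obtain ⟨k, hk, b, hb⟩ := hno j hjT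
          have hkj : k ≠ j := hP _ hb
          refine hext ⟨_, hb, rfl, ?_⟩
          have := hu k hk
          rw [hj, Function.update_of_ne hkj] at this
          exact this.trans (hnf.eq_panelSide hb).symm
        have := hu i hi
        rwa [hj, Function.update_of_ne (ne_of_mem_of_not_mem hi hjT)] at this
  obtain ⟨t, ht⟩ := hT
  have := key ⟨panelSide P, fun i hi => absurd (Set.mem_univ i) hi⟩
    ⟨fun i => !panelSide P i, fun i hi => absurd (Set.mem_univ i) hi⟩
    (hconn.preconnected _ _) (fun _ _ => rfl) t ht
  simp at this

theorem WellFounded.swap_of_finite {α : Type*} [Finite α] {r : α → α → Prop} (h : WellFounded r) :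
    WellFounded (Function.swap r) := by
  have hirr : Std.Irrefl (Relation.TransGen r) := h.transGen.irrefl
  have : WellFounded (Function.swap (Relation.TransGen r)) :=
    Finite.wellFounded_of_trans_of_irrefl _
  exact Subrelation.wf (r := Function.swap (Relation.TransGen r))
    (fun hab => Relation.TransGen.single hab) this

theorem mem_Dset_iff {d : ℕ} {P : Set (Fin d × Bool × Fin d)} (hnf : NoFacingPanels P)
    (x : Fin d → Set.Icc (0 : ℝ) 1) :
    x ∈ Dset P ↔ (fun i => (x i : ℝ)) ∈
      panelLocus (PanelRel P) (fun i => if panelSide P i then 0 else 1) Finset.univ ∅ := by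
  classical
  constructor
  · intro hx
    simp only [Dset, Set.mem_iUnion] at hx
    obtain ⟨S, g, hSg, hx⟩ := hx
    refine ⟨fun i => (x i).2, by simp, ?_⟩
    rintro i - j - ⟨b, hb⟩
    have hbi := hnf.eq_panelSide hb
    by_cases hj : j ∈ S
    · refine Or.inr ?_
      have hi : i ∉ S := fun hi =>
        hSg (Function.update g i b)
          (fun k hk => Function.update_of_ne (ne_of_mem_of_not_mem hi hk).symm _ _)
          j hj ⟨_, hb, rfl, by simp⟩
      have hgi : g i ≠ b := fun h => hSg g (fun _ _ => rfl) j hj ⟨_, hb, rfl, h⟩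
      have hxi := hx i hi
      rw [hbi] at hgi
      simp only [hxi]
      cases hg : g i <;> cases hp : panelSide P i <;> simp_all
    · refine Or.inl ?_
      have hxj := hx j hj
      cases hg : g j <;> simp_all
  · rintro ⟨-, -, h⟩
    simp only [Dset, Set.mem_iUnion]
    refine ⟨{j | ¬((x j : ℝ) = 0 ∨ (x j : ℝ) = 1)}, fun i => decide ((x i : ℝ) = 1), ?_, ?_⟩
    · rintro v hv j hj ⟨⟨i, b, j'⟩, hp, rfl, hvb⟩
      have hi := (h i (Finset.mem_univ _) j' (Finset.mem_univ _) ⟨b, hp⟩).resolve_left hj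
      have hb := hnf.eq_panelSide hp
      have hvi := hv i (by
        simp only [Set.mem_ofPred_eq, not_not]
        simp only at hi
        rw [hi]
        cases panelSide P i <;> simp)
      simp only at hvb hi hvi
      rw [hvb, hb, hi] at hvi
      cases hs : panelSide P i <;> simp [hs] at hvi
    · intro i hi
      simp only [Set.mem_ofPred_eq, not_not] at hi
      rcases hi with hi | hi <;> simp [hi]

/-- A space that is a retract of a contractible space is contractible. -/
theorem ContractibleSpace.of_leftInverse {X Y : Type*} [TopologicalSpace X] [TopologicalSpace Y]
    [ContractibleSpace X] (f : C(Y, X)) (g : C(X, Y)) (h : Function.LeftInverse g f) :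
    ContractibleSpace Y := by
  rw [contractible_iff_id_nullhomotopic]
  convert ((id_nullhomotopic X).comp_right g).comp_left f using 1
  ext y
  exact (h y).symm

/-- If `P` has no facing panels and the external-edge graph of the
full hypercube is connected, then `𝒟` is a strong deformation retract of the geometric
cube; in particular `𝒟` is contractible. -/
theorem Dset_strong_deformation_retract (d : ℕ) (P : Set (Fin d × Bool × Fin d))
    (hP : IsPanelData P) (hnf : NoFacingPanels P)
    (hconn : (extGraph P (Set.univ : Set (Fin d)) (fun _ => false)).Connected) :
    (∃ H : ((Fin d → Set.Icc (0:ℝ) 1) × Set.Icc (0:ℝ) 1) → (Fin d → Set.Icc (0:ℝ) 1),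
      Continuous H ∧
      (∀ x, H (x, ⟨0, by norm_num⟩) = x) ∧
      (∀ x, H (x, ⟨1, by norm_num⟩) ∈ Dset P) ∧
      (∀ a ∈ Dset P, ∀ t, H (a, t) = a)) ∧
    ContractibleSpace (Dset P) := by
  obtain ⟨r, hrc, hrD, hr⟩ := panelLocus_retract (PanelRel P)
    (wellFounded_panelRel hP hnf hconn).swap_of_finite
    (fun i => if panelSide P i then 0 else 1) (fun i => by cases panelSide P i <;> simp)
    Finset.univ ∅
  let ρ : (Fin d → ℝ) → Fin d → Set.Icc (0:ℝ) 1 := fun x i => ⟨r x i, (hrD _).1 i⟩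
  have hρc : Continuous ρ := by fun_prop
  have hρD : ∀ x, ρ x ∈ Dset P := fun x => (mem_Dset_iff hnf _).2 (hrD _)
  have hρ : ∀ x ∈ Dset P, ρ (fun i => x i) = x := by
    intro x hx
    funext i
    exact Subtype.ext (congrFun (hr _ ((mem_Dset_iff hnf x).1 hx)) i)
  refine ⟨⟨fun q i => ⟨(1 - (q.2 : ℝ)) * (q.1 i : ℝ) + (q.2 : ℝ) * (ρ (fun k => q.1 k) i : ℝ),
    ?_⟩, ?_, ?_, ?_, ?_⟩, ?_⟩
  · exact convex_Icc (0:ℝ) 1 (q.1 i).2 (ρ _ i).2 (sub_nonneg.2 q.2.2.2) q.2.2.1 (by ring)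
  · fun_prop
  · intro x
    funext i
    simp
  · intro x
    convert hρD (fun i => x i) using 1
    funext i
    simp
  · intro a ha t
    funext i
    refine Subtype.ext ?_
    simp only [hρ a ha]
    ring
  · exact ContractibleSpace.of_leftInverse (X := Fin d → ℝ)
      ⟨fun a i => a.1 i, continuous_pi fun i => continuous_subtype_val.comp
        ((continuous_apply i).comp continuous_subtype_val)⟩ ⟨fun x => ⟨ρ x, hρD x⟩, by fun_prop⟩
      fun a => Subtype.ext (hρ a.1 a.2)
end

section
/- Suppose 𝒫 has no facing panels. Then every external codimension-1 face C({k}ᶜ, g) contains a persistent corner. -/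
/-- If `P` has no facing panels, then every external codimension-1
face contains a persistent corner. -/
theorem external_face_has_persistent_corner (d : ℕ) (P : Set (Fin d × Bool × Fin d))
    (hP : IsPanelData P) (hnf : NoFacingPanels P) (k : Fin d) (g : Fin d → Bool)
    (hext : ExternalCube P ({k}ᶜ : Set (Fin d)) g) :
    ∃ v ∈ Cube ({k}ᶜ : Set (Fin d)) g, PersistentCorner P v := by
  classical
  refine ⟨fun i => if i = k then g k else decide (∃ j, (i, false, j) ∈ P), ?_, ?_⟩
  · intro i hi
    obtain rfl : i = k := by simpa using hi
    simp
  · rintro j ⟨⟨i, b, j'⟩, hp, -, hv⟩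
    have hij : i ≠ j' := hP _ hp
    by_cases hik : i = k
    · subst hik
      exact hext ⟨_, hp, by simpa using hij.symm, by simp, by simpa using hv⟩
    · cases b with
      | false =>
        simp only [hik, if_false, decide_eq_false_iff_not] at hv
        exact hv ⟨j', hp⟩
      | true =>
        simp only [hik, if_false, decide_eq_true_eq] at hv
        exact hnf ⟨i, ⟨j', hp⟩, hv⟩
end

section
/- Suppose 𝒫 has no facing panels. If C(S, g) and C(S', g') are external subcubes whose intersection is nonempty, then there exists g'' : Fin d → Bool such that C(S, g) ∩ C(S', g') = C(S ∩ S', g''), and this subcube is external. -/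
/-- If `P` has no facing panels, the intersection of two external
subcubes, when nonempty, is an external subcube on the intersection of the two
direction sets. -/
theorem external_inter_external (d : ℕ) (P : Set (Fin d × Bool × Fin d))
    (hP : IsPanelData P) (hnf : NoFacingPanels P)
    (S S' : Set (Fin d)) (g g' : Fin d → Bool)
    (hS : ExternalCube P S g) (hS' : ExternalCube P S' g')
    (hne : (Cube S g ∩ Cube S' g').Nonempty) :
    ∃ g'' : Fin d → Bool, Cube S g ∩ Cube S' g' = Cube (S ∩ S') g'' ∧
      ExternalCube P (S ∩ S') g'' := by
  obtain ⟨v, hv, hv'⟩ := hne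
  refine ⟨v, ?_, ?_⟩
  · ext w
    constructor
    · rintro ⟨hw, hw'⟩ i hi
      by_cases hiS : i ∈ S
      · have hiS' : i ∉ S' := fun h => hi ⟨hiS, h⟩
        rw [hw' i hiS', hv' i hiS']
      · rw [hw i hiS, hv i hiS]
    · intro hw
      exact ⟨fun i hi => (hw i fun h => hi h.1).trans (hv i hi),
        fun i hi => (hw i fun h => hi h.2).trans (hv' i hi)⟩
  · rintro ⟨p, hp, ⟨hjS, hjS'⟩, hi, hvp⟩
    by_cases hiS : p.1 ∈ S
    · have hiS' : p.1 ∉ S' := fun h => hi ⟨hiS, h⟩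
      exact hS' ⟨p, hp, hjS', hiS', (hv' _ hiS').symm.trans hvp⟩
    · exact hS ⟨p, hp, hjS, hiS, (hv _ hiS).symm.trans hvp⟩
end

section
/- Suppose 𝒫 has no facing panels and 𝒫 is nonempty. Then there is at most one subcube that is completely external, maximal among completely external subcubes with respect to inclusion of vertex sets, and not contained in any codimension-1 face containing a persistent corner; i.e., any two subcubes with these three properties are equal as vertex sets. -/
/-- Without facing panels, a subcube not contained in any codimension-1 face containing a
persistent corner is carved out by panels in every direction it does not span. -/
theorem exists_panel_of_not_subset_face {d : ℕ} {P : Set (Fin d × Bool × Fin d)}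
    (hnf : NoFacingPanels P) {S : Set (Fin d)} {g : Fin d → Bool}
    (hface : ¬ ∃ (k : Fin d) (g' : Fin d → Bool),
      Cube S g ⊆ Cube ({k}ᶜ : Set (Fin d)) g' ∧
        ∃ v ∈ Cube ({k}ᶜ : Set (Fin d)) g', PersistentCorner P v)
    {k : Fin d} (hk : k ∉ S) : ∃ j, (k, g k, j) ∈ P := by
  classical
  by_contra hno
  refine hface ⟨k, g, ?_, fun i => if i = k then g k else !decide (∃ j, (i, true, j) ∈ P), ?_, ?_⟩
  · intro v hv i hi
    obtain rfl : i = k := by simpa using hi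
    exact hv i hk
  · intro i hi
    obtain rfl : i = k := by simpa using hi
    simp
  · rintro j ⟨⟨i, b, j'⟩, hp, -, hv⟩
    dsimp only at hv
    split_ifs at hv with hik
    · subst hik
      subst hv
      exact hno ⟨j', hp⟩
    · cases b
      · have ht : ∃ j, (i, true, j) ∈ P := by simpa using hv
        exact hnf ⟨i, ht, j', hp⟩
      · have hf : ∀ j, (i, true, j) ∉ P := by simpa using hv
        exact hf j' hp

/-- If a completely external subcube is carved out by panels in every direction it does not span,
then no panel datum has its third coordinate among the directions of the subcube. -/
theorem CompletelyExternal.third_notMem {d : ℕ} {P : Set (Fin d × Bool × Fin d)}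
    (hnf : NoFacingPanels P) {S : Set (Fin d)} {g : Fin d → Bool}
    (hce : CompletelyExternal P S g) (hpanel : ∀ k ∉ S, ∃ j, (k, g k, j) ∈ P)
    {p : Fin d × Bool × Fin d} (hp : p ∈ P) : p.2.2 ∉ S := by
  obtain ⟨i, b, j⟩ := p
  intro hj
  by_cases hi : i ∈ S
  · refine hce (Function.update g i b) ?_ j hj ⟨_, hp, rfl, by simp⟩
    intro k hk
    exact Function.update_of_ne (ne_of_mem_of_not_mem hi hk).symm _ _
  · obtain ⟨j', hj'⟩ := hpanel i hi
    refine hce g (fun _ _ => rfl) j hj ⟨_, hp, rfl, ?_⟩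
    by_contra hgb
    dsimp only at hgb
    cases b
    · rw [Bool.not_eq_false] at hgb
      exact hnf ⟨i, ⟨j', hgb ▸ hj'⟩, j, hp⟩
    · rw [Bool.not_eq_true] at hgb
      exact hnf ⟨i, ⟨j, hp⟩, j', hgb ▸ hj'⟩

/-- If `P` has no facing panels and is nonempty, then any two
completely external subcubes which are maximal among completely external subcubes and
not contained in any codimension-1 face containing a persistent corner are equal as
vertex sets. -/
theorem maximal_completelyExternal_unique (d : ℕ) (P : Set (Fin d × Bool × Fin d))
    (hP : IsPanelData P) (hnf : NoFacingPanels P) (hne : P.Nonempty)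
    (S₁ S₂ : Set (Fin d)) (g₁ g₂ : Fin d → Bool)
    (hce₁ : CompletelyExternal P S₁ g₁) (hce₂ : CompletelyExternal P S₂ g₂)
    (hmax₁ : ∀ (S' : Set (Fin d)) (g' : Fin d → Bool), CompletelyExternal P S' g' →
      Cube S₁ g₁ ⊆ Cube S' g' → Cube S₁ g₁ = Cube S' g')
    (hmax₂ : ∀ (S' : Set (Fin d)) (g' : Fin d → Bool), CompletelyExternal P S' g' →
      Cube S₂ g₂ ⊆ Cube S' g' → Cube S₂ g₂ = Cube S' g')
    (hface₁ : ¬ ∃ (k : Fin d) (g' : Fin d → Bool),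
      Cube S₁ g₁ ⊆ Cube ({k}ᶜ : Set (Fin d)) g' ∧
        ∃ v ∈ Cube ({k}ᶜ : Set (Fin d)) g', PersistentCorner P v)
    (hface₂ : ¬ ∃ (k : Fin d) (g' : Fin d → Bool),
      Cube S₂ g₂ ⊆ Cube ({k}ᶜ : Set (Fin d)) g' ∧
        ∃ v ∈ Cube ({k}ᶜ : Set (Fin d)) g', PersistentCorner P v) :
    Cube S₁ g₁ = Cube S₂ g₂ := by
  have hpanel₁ := fun k (hk : k ∉ S₁) => exists_panel_of_not_subset_face hnf hface₁ hk
  have hpanel₂ := fun k (hk : k ∉ S₂) => exists_panel_of_not_subset_face hnf hface₂ hk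
  have hce (g : Fin d → Bool) : CompletelyExternal P (S₁ ∪ S₂) g := by
    rintro v - j hj ⟨p, hp, rfl, -⟩
    exact hj.elim (hce₁.third_notMem hnf hpanel₁ hp) (hce₂.third_notMem hnf hpanel₂ hp)
  have hg : ∀ k ∉ S₁ ∪ S₂, g₁ k = g₂ k := by
    intro k hk
    obtain ⟨j₁, h₁⟩ := hpanel₁ k fun h => hk (Or.inl h)
    obtain ⟨j₂, h₂⟩ := hpanel₂ k fun h => hk (Or.inr h)
    cases e₁ : g₁ k <;> cases e₂ : g₂ k <;> rw [e₁] at h₁ <;> rw [e₂] at h₂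
    · exact (hnf ⟨k, ⟨j₂, h₂⟩, j₁, h₁⟩).elim
    · exact (hnf ⟨k, ⟨j₁, h₁⟩, j₂, h₂⟩).elim
  rw [hmax₁ _ g₁ (hce g₁) fun v hv i hi => hv i fun h => hi (Or.inl h),
    hmax₂ _ g₂ (hce g₂) fun v hv i hi => hv i fun h => hi (Or.inr h)]
  ext v
  exact forall₂_congr fun k hk => by rw [hg k hk]
end

section
/- Let φ be an automorphism of T. Suppose that for every finite set A ⊆ V there exists an automorphism ψ of T that preserves 𝓛 and satisfies ψ a = φ a and ψ⁻¹ a = φ⁻¹ a for all a ∈ A. Then φ preserves 𝓛. (Equivalently: the set of pattern-preserving automorphisms of T is a closed subgroup of the automorphism group of T in the topology of pointwise convergence of an automorphism and its inverse.) -/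
/-- A line in a graph `T`: the vertex set of a bi-infinite geodesic. -/
def IsLine {V : Type*} (T : SimpleGraph V) (l : Set V) : Prop :=
  ∃ f : ℤ → V, (∀ m n : ℤ, (T.dist (f m) (f n) : ℤ) = |m - n|) ∧ l = Set.range f

/-- A line pattern in `T`: a set of lines with uniformly bounded pairwise
intersections. -/
def IsLinePattern {V : Type*} (T : SimpleGraph V) (L : Set (Set V)) : Prop :=
  (∀ l ∈ L, IsLine T l) ∧
    ∃ N : ℕ, ∀ l ∈ L, ∀ l' ∈ L, l ≠ l' → (l ∩ l').Finite ∧ (l ∩ l').ncard ≤ N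

/-- A line is an infinite set of vertices. -/
theorem IsLine.infinite {V : Type*} {T : SimpleGraph V} {l : Set V} (h : IsLine T l) :
    l.Infinite := by
  obtain ⟨f, hf, rfl⟩ := h
  refine Set.infinite_range_of_injective fun m n hmn => ?_
  have hd := hf m n
  rw [hmn, SimpleGraph.dist_self, Nat.cast_zero, eq_comm, abs_eq_zero] at hd
  exact sub_eq_zero.mp hd

/-- Two members of a line pattern sharing more points than the intersection bound agree. Hence if
`φ` agrees on finite sets, together with its inverse, with permutations mapping the pattern into
itself, then `φ` maps the pattern into itself. -/
theorem IsLinePattern.image_mem_of_approx {V : Type*} {T : SimpleGraph V} {L : Set (Set V)}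
    (hL : IsLinePattern T L) {φ : V ≃ V}
    (happrox : ∀ A : Set V, A.Finite → ∃ ψ : V ≃ V, (∀ l ∈ L, ψ '' l ∈ L) ∧
      ∀ a ∈ A, ψ a = φ a ∧ ψ.symm a = φ.symm a)
    {l : Set V} (hl : l ∈ L) : φ '' l ∈ L := by
  obtain ⟨hline, N, hN⟩ := hL
  obtain ⟨S, hSl, hS⟩ := (hline l hl).infinite.exists_subset_card_eq (N + 1)
  have heq : ∀ ψ ψ' : V ≃ V, (∀ l ∈ L, ψ '' l ∈ L) → (∀ l ∈ L, ψ' '' l ∈ L) →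
      (∀ a ∈ S, ψ a = φ a) → (∀ a ∈ S, ψ' a = φ a) → ψ '' l = ψ' '' l := by
    intro ψ ψ' hψ hψ' hψS hψ'S
    by_contra hne
    obtain ⟨hfin, hcard⟩ := hN _ (hψ l hl) _ (hψ' l hl) hne
    have hsub : φ '' (S : Set V) ⊆ ψ '' l ∩ ψ' '' l := by
      rintro _ ⟨a, ha, rfl⟩
      exact ⟨⟨a, hSl ha, hψS a ha⟩, ⟨a, hSl ha, hψ'S a ha⟩⟩
    have hle := Set.ncard_le_ncard hsub hfin
    rw [Set.ncard_image_of_injective _ φ.injective, Set.ncard_coe_finset, hS] at hle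
    omega
  obtain ⟨ψ, hψ, hψS⟩ := happrox S S.finite_toSet
  have happrox' : ∀ b, ∃ ψ' : V ≃ V, ψ' '' l = ψ '' l ∧ ψ' b = φ b ∧ ψ'.symm b = φ.symm b := by
    intro b
    obtain ⟨ψ', hψ', hψ'S⟩ := happrox (insert b S) (S.finite_toSet.insert b)
    exact ⟨ψ', heq ψ' ψ hψ' hψ (fun a ha => (hψ'S a (Set.mem_insert_of_mem b ha)).1)
      (fun a ha => (hψS a ha).1), hψ'S b (Set.mem_insert b S)⟩
  suffices φ '' l = ψ '' l from this ▸ hψ l hl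
  apply Set.Subset.antisymm
  · rintro _ ⟨a, ha, rfl⟩
    obtain ⟨ψ', him, hb, -⟩ := happrox' a
    exact him ▸ ⟨a, ha, hb⟩
  · intro b hb
    obtain ⟨ψ', him, -, hsymm⟩ := happrox' b
    rw [← him, Equiv.image_eq_preimage_symm, Set.mem_preimage, hsymm] at hb
    exact ⟨φ.symm b, hb, φ.apply_symm_apply b⟩

/-- The pattern-preserving automorphisms of a locally finite tree
form a closed subgroup of the automorphism group in the topology of pointwise
convergence of an automorphism and its inverse: any automorphism `φ` that agrees, on
each finite set, with some pattern-preserving automorphism (and likewise for inverses)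
is itself pattern preserving. -/
theorem patternPreserving_isClosed {V : Type*} (T : SimpleGraph V)
    (htree : T.IsTree) (hlf : ∀ v : V, (T.neighborSet v).Finite)
    (L : Set (Set V)) (hL : IsLinePattern T L)
    (φ : V ≃ V) (hφ : ∀ u v : V, T.Adj u v ↔ T.Adj (φ u) (φ v))
    (happrox : ∀ A : Set V, A.Finite → ∃ ψ : V ≃ V,
      (∀ u v : V, T.Adj u v ↔ T.Adj (ψ u) (ψ v)) ∧
      ((fun l => ψ '' l) '' L = L) ∧
      ∀ a ∈ A, ψ a = φ a ∧ ψ.symm a = φ.symm a) :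
    (fun l => φ '' l) '' L = L := by
  apply Set.Subset.antisymm
  · rintro _ ⟨l, hl, rfl⟩
    refine hL.image_mem_of_approx (fun A hA => ?_) hl
    obtain ⟨ψ, -, hψ, hψA⟩ := happrox A hA
    exact ⟨ψ, fun l hl => hψ ▸ Set.mem_image_of_mem _ hl, hψA⟩
  · intro l hl
    refine ⟨φ.symm '' l, hL.image_mem_of_approx (fun A hA => ?_) hl, φ.image_symm_image l⟩
    obtain ⟨ψ, -, hψ, hψA⟩ := happrox A hA
    refine ⟨ψ.symm, fun l hl => ?_, fun a ha => (hψA a ha).symm⟩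
    rw [← hψ] at hl
    obtain ⟨m, hm, rfl⟩ := hl
    simpa only [Equiv.symm_image_image] using hm
end
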